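/- On the open unit disc {z ∈ ℂ : |z| < 1}, the generating function of the sequence of dimensions of G-invariant harmonic polynomial spaces satisfies F_q(z) = (1/q)·∑_{l=1}^{q} (1 - z²)/∏_{i=1}^{n}(z - γ^{p_i l})(z - γ^{-p_i l}), where γ = e^{2πi/q}. -/

import Mathlib

noncomputable section

open scoped Real
open MvPolynomial

/-- The standard primitive `q`-th root of unity. -/
def rootU (q : ℕ) : ℂ := Complex.exp (2 * π * Complex.I / q)

/-- Complex polynomials on `ℝ^{2n} ≃ ℂⁿ`, written in the variables
`z₁,…,zₙ, z̄₁,…,z̄ₙ` (left summand: `zᵢ`, right summand: `z̄ᵢ`). -/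
abbrev CPoly (n : ℕ) := MvPolynomial (Fin n ⊕ Fin n) ℂ

/-- The Laplacian on `ℝ^{2n}` (up to the factor 4): `∑ᵢ ∂²/∂zᵢ∂z̄ᵢ`. -/
def laplacian (n : ℕ) : CPoly n →ₗ[ℂ] CPoly n :=
  ∑ i : Fin n,
    (MvPolynomial.pderiv (Sum.inr i)).toLinearMap ∘ₗ
      (MvPolynomial.pderiv (Sum.inl i)).toLinearMap

/-- The substitution action of `gˡ` on polynomials, where `g` is the generator of
the cyclic group `G ⊂ SO(2n)` with rotation blocks `R(pᵢ/q)`: in complex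
coordinates, `zᵢ ↦ γ^{pᵢ l} zᵢ` and `z̄ᵢ ↦ γ^{-pᵢ l} z̄ᵢ`. -/
def gAct (q n : ℕ) (p : Fin n → ℤ) (l : ℤ) : CPoly n →ₐ[ℂ] CPoly n :=
  MvPolynomial.aeval
    (Sum.elim (fun i => rootU q ^ (p i * l) • (X (Sum.inl i) : CPoly n))
      (fun i => rootU q ^ (-(p i) * l) • (X (Sum.inr i) : CPoly n)))

/-- The space `𝓗ᵏ_G` of `G`-invariant harmonic homogeneous polynomials of
degree `k`. -/
def HkG (q n : ℕ) (p : Fin n → ℤ) (k : ℕ) : Submodule ℂ (CPoly n) :=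
  MvPolynomial.homogeneousSubmodule (Fin n ⊕ Fin n) ℂ k ⊓
    LinearMap.ker (laplacian n) ⊓
    ⨅ l : ℤ, LinearMap.ker ((gAct q n p l).toLinearMap - LinearMap.id)

/-- weight of a monomial -/
def wt (n : ℕ) (p : Fin n → ℤ) (m : Fin n ⊕ Fin n →₀ ℕ) : ℤ :=
  ∑ i, p i * ((m (Sum.inl i) : ℤ) - (m (Sum.inr i) : ℤ))

lemma wt_add (n : ℕ) (p : Fin n → ℤ) (a b : Fin n ⊕ Fin n →₀ ℕ) :
    wt n p (a + b) = wt n p a + wt n p b := by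
  simp only [wt, ← Finset.sum_add_distrib]
  refine Finset.sum_congr rfl fun i _ => ?_
  simp only [Finsupp.add_apply]
  push_cast
  ring

/-- eigenvalues -/
def ev (q n : ℕ) (p : Fin n → ℤ) (l : ℤ) : Fin n ⊕ Fin n → ℂ :=
  Sum.elim (fun i => rootU q ^ (p i * l)) (fun i => rootU q ^ (-(p i) * l))

lemma rootU_ne (q : ℕ) : rootU q ≠ 0 := Complex.exp_ne_zero _

lemma zpow_sum' {ι : Type*} (s : Finset ι) (a : ℂ) (ha : a ≠ 0) (f : ι → ℤ) :
    ∏ i ∈ s, a ^ f i = a ^ (∑ i ∈ s, f i) := by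
  classical
  induction s using Finset.induction_on with
  | empty => simp
  | insert x s hx ih => rw [Finset.prod_insert hx, Finset.sum_insert hx, zpow_add₀ ha, ih]

lemma prod_ev (q n : ℕ) (p : Fin n → ℤ) (l : ℤ) (m : Fin n ⊕ Fin n →₀ ℕ) :
    ∏ s, ev q n p l s ^ m s = rootU q ^ (wt n p m * l) := by
  rw [Fintype.prod_sum_type, ← Finset.prod_mul_distrib, wt, Finset.sum_mul,
    ← zpow_sum' _ _ (rootU_ne q)]
  refine Finset.prod_congr rfl fun i _ => ?_
  simp only [ev, Sum.elim_inl, Sum.elim_inr]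
  rw [← zpow_natCast, ← zpow_natCast, ← zpow_mul, ← zpow_mul, ← zpow_add₀ (rootU_ne q)]
  congr 1
  ring

lemma gAct_monomial (q n : ℕ) (p : Fin n → ℤ) (l : ℤ) (m : Fin n ⊕ Fin n →₀ ℕ) (a : ℂ) :
    gAct q n p l (monomial m a) = monomial m (rootU q ^ (wt n p m * l) * a) := by
  rw [gAct, aeval_monomial, Finsupp.prod_fintype _ _ (fun i => by simp)]
  have h : ∀ s : Fin n ⊕ Fin n, (Sum.elim
      (fun i => rootU q ^ (p i * l) • (X (Sum.inl i) : CPoly n))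
      (fun i => rootU q ^ (-(p i) * l) • (X (Sum.inr i) : CPoly n)) s) ^ m s
      = C (ev q n p l s ^ m s) * X s ^ m s := by
    rintro (i | i) <;> simp only [ev, smul_eq_C_mul, mul_pow, Sum.elim_inl, Sum.elim_inr, C_pow]
  rw [Finset.prod_congr rfl (fun s _ => h s), Finset.prod_mul_distrib, ← map_prod, prod_ev,
    monomial_eq, Finsupp.prod_fintype _ _ (fun i => by simp), C_mul, algebraMap_eq]
  ring

lemma coeff_gAct (q n : ℕ) (p : Fin n → ℤ) (l : ℤ) (m : Fin n ⊕ Fin n →₀ ℕ) (f : CPoly n) :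
    coeff m (gAct q n p l f) = rootU q ^ (wt n p m * l) * coeff m f := by
  classical
  induction f using MvPolynomial.induction_on' with
  | monomial u a =>
    rw [gAct_monomial, coeff_monomial, coeff_monomial]
    split_ifs with h
    · rw [h]
    · simp
  | add f g hf hg => rw [map_add, coeff_add, hf, hg, coeff_add, mul_add]

/-- exponents of invariant monomials of degree k -/
def SS (q n : ℕ) (p : Fin n → ℤ) (k : ℕ) : Finset (Fin n ⊕ Fin n →₀ ℕ) :=
  (Finset.finsuppAntidiag Finset.univ k).filter (fun m => (q : ℤ) ∣ wt n p m)

lemma mem_SS (q n : ℕ) (p : Fin n → ℤ) (k : ℕ) (m : Fin n ⊕ Fin n →₀ ℕ) :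
    m ∈ SS q n p k ↔ ∑ s, m s = k ∧ (q : ℤ) ∣ wt n p m := by
  simp [SS]

lemma prim (q : ℕ) (hq : 0 < q) : IsPrimitiveRoot (rootU q) q :=
  Complex.isPrimitiveRoot_exp q hq.ne'

/-- invariant polynomials -/
def WW (q n : ℕ) (p : Fin n → ℤ) (k : ℕ) : Submodule ℂ (CPoly n) :=
  restrictSupport ℂ (SS q n p k : Set (Fin n ⊕ Fin n →₀ ℕ))

lemma HkG_eq (q n : ℕ) (hq : 0 < q) (p : Fin n → ℤ) (k : ℕ) :
    HkG q n p k = WW q n p k ⊓ LinearMap.ker (laplacian n) := by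
  have : homogeneousSubmodule (Fin n ⊕ Fin n) ℂ k ⊓
      (⨅ l : ℤ, LinearMap.ker ((gAct q n p l).toLinearMap - LinearMap.id)) = WW q n p k := by
    ext f
    simp only [Submodule.mem_inf, Submodule.mem_iInf, LinearMap.mem_ker, LinearMap.sub_apply,
      LinearMap.id_apply, sub_eq_zero, AlgHom.toLinearMap_apply, mem_homogeneousSubmodule, WW,
      mem_restrictSupport_iff]
    constructor
    · rintro ⟨h1, h2⟩ m hm
      have hm' : coeff m f ≠ 0 := by simpa using hm
      rw [Finset.mem_coe, mem_SS]
      constructor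
      · have := h1 hm'
        rw [← this, Finsupp.weight_apply, Finsupp.sum_fintype _ _ (by simp)]
        simp
      · have h3 := congrArg (coeff m) (h2 1)
        rw [coeff_gAct, mul_one] at h3
        exact ((prim q hq).zpow_eq_one_iff_dvd _).1 (mul_right_cancel₀ hm' (h3.trans (one_mul _).symm))
    · intro h
      have h' : ∀ m, coeff m f ≠ 0 → ∑ s, m s = k ∧ (q : ℤ) ∣ wt n p m := fun m hm => by
        rw [← mem_SS, ← Finset.mem_coe]
        exact h (by simpa using hm)
      constructor
      · intro m hm
        rw [← (h' m hm).1, Finsupp.weight_apply, Finsupp.sum_fintype _ _ (by simp)]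
        simp
      · intro l
        ext m
        rw [coeff_gAct]
        by_cases hm : coeff m f = 0
        · simp [hm]
        · rw [((prim q hq).zpow_eq_one_iff_dvd _).2 ((h' m hm).2.mul_right l), one_mul]
  rw [HkG, ← this]
  ac_rfl

lemma finrank_WW (q n : ℕ) (p : Fin n → ℤ) (k : ℕ) :
    Module.finrank ℂ (WW q n p k) = (SS q n p k).card := by
  rw [WW, Module.finrank_eq_card_basis (basisRestrictSupport ℂ (SS q n p k : Set (Fin n ⊕ Fin n →₀ ℕ)))]
  simp

instance (q n : ℕ) (p : Fin n → ℤ) (k : ℕ) : Module.Finite ℂ (WW q n p k) :=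
  Module.Finite.of_basis (basisRestrictSupport ℂ (SS q n p k : Set (Fin n ⊕ Fin n →₀ ℕ)))

/-- the exponent of `z_j z̄_j` -/
def ee (n : ℕ) (j : Fin n) : Fin n ⊕ Fin n →₀ ℕ :=
  Finsupp.single (Sum.inl j) 1 + Finsupp.single (Sum.inr j) 1

lemma laplacian_monomial (n : ℕ) (m : Fin n ⊕ Fin n →₀ ℕ) (a : ℂ) :
    laplacian n (monomial m a) =
      ∑ j, monomial (m - ee n j) (a * m (Sum.inl j) * m (Sum.inr j)) := by
  simp only [laplacian, LinearMap.sum_apply, LinearMap.comp_apply, Derivation.coeFn_coe,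
    pderiv_monomial, ee]
  refine Finset.sum_congr rfl fun j _ => ?_
  rw [tsub_add_eq_tsub_tsub]
  simp

lemma add_ee_mem (q n : ℕ) (p : Fin n → ℤ) (k : ℕ) (m : Fin n ⊕ Fin n →₀ ℕ) (j : Fin n) :
    m + ee n j ∈ SS q n p (k + 2) ↔ m ∈ SS q n p k := by
  have h1 : ∑ s, (m + ee n j) s = ∑ s, m s + 2 := by
    simp [Finset.sum_add_distrib, ee, Finsupp.single_apply]
  have h2 : wt n p (ee n j) = 0 := by
    refine Finset.sum_eq_zero fun i _ => ?_
    simp [ee, Finsupp.single_apply]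
  rw [mem_SS, mem_SS, h1, wt_add, h2]
  simp

lemma sub_ee_add (n : ℕ) (m : Fin n ⊕ Fin n →₀ ℕ) (j : Fin n)
    (h1 : m (Sum.inl j) ≠ 0) (h2 : m (Sum.inr j) ≠ 0) : m - ee n j + ee n j = m := by
  refine tsub_add_cancel_of_le ?_
  rintro (i | i)
  · simp only [ee, Finsupp.add_apply, Finsupp.single_apply, Sum.inl.injEq, reduceCtorEq, if_false]
    split_ifs with h
    · subst h; omega
    · omega
  · simp only [ee, Finsupp.add_apply, Finsupp.single_apply, Sum.inr.injEq, reduceCtorEq, if_false]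
    split_ifs with h
    · subst h; omega
    · omega

lemma map_le (q n : ℕ) (p : Fin n → ℤ) (k : ℕ) :
    (WW q n p (k + 2)).map (laplacian n) ≤ WW q n p k := by
  rw [Submodule.map_le_iff_le_comap, WW, restrictSupport_eq_span, Submodule.span_le]
  rintro _ ⟨m, hm, rfl⟩
  simp only [Submodule.comap_coe, Set.mem_preimage, SetLike.mem_coe]
  rw [laplacian_monomial]
  refine Submodule.sum_mem _ fun j _ => ?_
  rw [WW, monomial_mem_restrictSupport]
  by_cases h1 : m (Sum.inl j) = 0
  · right; simp [h1]
  by_cases h2 : m (Sum.inr j) = 0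
  · right; simp [h2]
  left
  rw [Finset.mem_coe, ← add_ee_mem q n p k _ j, sub_ee_add n m j h1 h2]
  exact hm

lemma le_map (q n : ℕ) (hn : 0 < n) (p : Fin n → ℤ) (k : ℕ) :
    WW q n p k ≤ (WW q n p (k + 2)).map (laplacian n) := by
  let i : Fin n := ⟨0, hn⟩
  have key : ∀ d : ℕ, ∀ m ∈ SS q n p k, k - m (Sum.inl i) = d →
      monomial m (1 : ℂ) ∈ (WW q n p (k + 2)).map (laplacian n) := by
    intro d
    induction d using Nat.strong_induction_on with
    | _ d ih =>
      intro m hm hd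
      have hL := laplacian_monomial n (m + ee n i) 1
      have hmem : laplacian n (monomial (m + ee n i) 1) ∈
          (WW q n p (k + 2)).map (laplacian n) := by
        refine Submodule.mem_map_of_mem ?_
        rw [WW, monomial_mem_restrictSupport]
        left
        exact (add_ee_mem q n p k m i).2 hm
      rw [hL, ← Finset.add_sum_erase _ _ (Finset.mem_univ i)] at hmem
      have hrest : ∑ j ∈ Finset.univ.erase i, monomial (m + ee n i - ee n j)
          ((1 : ℂ) * (m + ee n i) (Sum.inl j) * (m + ee n i) (Sum.inr j)) ∈
          (WW q n p (k + 2)).map (laplacian n) := by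
        refine Submodule.sum_mem _ fun j hj => ?_
        have hj' : j ≠ i := (Finset.mem_erase.1 hj).1
        by_cases h1 : (m + ee n i) (Sum.inl j) = 0
        · rw [h1]; simp
        by_cases h2 : (m + ee n i) (Sum.inr j) = 0
        · rw [h2]; simp
        rw [← mul_one ((1 : ℂ) * (m + ee n i) (Sum.inl j) * (m + ee n i) (Sum.inr j)),
          ← smul_eq_mul, ← smul_monomial]
        refine Submodule.smul_mem _ _ ?_
        have hS : m + ee n i - ee n j ∈ SS q n p k := by
          rw [← add_ee_mem q n p k _ j, sub_ee_add n _ j h1 h2, add_ee_mem]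
          exact hm
        have hv : (m + ee n i - ee n j) (Sum.inl i) = m (Sum.inl i) + 1 := by
          simp [ee, Finsupp.single_apply, hj']
        have hle : (m + ee n i - ee n j) (Sum.inl i) ≤ k := by
          rw [← ((mem_SS q n p k _).1 hS).1]
          exact Finset.single_le_sum (f := fun s => (m + ee n i - ee n j) s)
            (fun _ _ => Nat.zero_le _) (Finset.mem_univ _)
        exact ih (k - (m + ee n i - ee n j) (Sum.inl i)) (by omega) _ hS rfl
      have h3 := (Submodule.add_mem_iff_left _ hrest).1 hmem
      rw [add_tsub_cancel_right, ← mul_one ((1 : ℂ) * (m + ee n i) (Sum.inl i) *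
        (m + ee n i) (Sum.inr i)), ← smul_eq_mul, ← smul_monomial] at h3
      refine (Submodule.smul_mem_iff _ ?_).1 h3
      have a1 : (m + ee n i) (Sum.inl i) ≠ 0 := by simp [ee]
      have a2 : (m + ee n i) (Sum.inr i) ≠ 0 := by simp [ee]
      rw [one_mul]
      exact mul_ne_zero (Nat.cast_ne_zero.2 a1) (Nat.cast_ne_zero.2 a2)
  conv_lhs => rw [WW, restrictSupport_eq_span]
  rw [Submodule.span_le]
  rintro _ ⟨m, hm, rfl⟩
  exact key _ m hm rfl

lemma finrank_inf_ker {V V' : Type*} [AddCommGroup V] [Module ℂ V] [AddCommGroup V']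
    [Module ℂ V'] (f : V →ₗ[ℂ] V') (W : Submodule ℂ V) [Module.Finite ℂ W] :
    Module.finrank ℂ (W.map f) + Module.finrank ℂ (W ⊓ LinearMap.ker f : Submodule ℂ V)
      = Module.finrank ℂ W := by
  have h := LinearMap.finrank_range_add_finrank_ker (f.comp W.subtype)
  rw [LinearMap.range_comp, Submodule.range_subtype, LinearMap.ker_comp,
    ← Submodule.finrank_map_subtype_eq, Submodule.map_comap_subtype] at h
  exact h

lemma finrank_add_two (q n : ℕ) (hq : 0 < q) (hn : 0 < n) (p : Fin n → ℤ) (k : ℕ) :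
    (SS q n p k).card + Module.finrank ℂ (HkG q n p (k + 2)) = (SS q n p (k + 2)).card := by
  rw [HkG_eq q n hq, ← finrank_WW, ← finrank_WW, ← finrank_inf_ker (laplacian n) (WW q n p (k + 2)),
    le_antisymm (map_le q n p k) (le_map q n hn p k)]

lemma finrank_lt_two (q n : ℕ) (hq : 0 < q) (p : Fin n → ℤ) (k : ℕ) (hk : k < 2) :
    Module.finrank ℂ (HkG q n p k) = (SS q n p k).card := by
  rw [HkG_eq q n hq, ← finrank_WW, inf_eq_left.2]
  rw [WW, restrictSupport_eq_span, Submodule.span_le]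
  rintro _ ⟨m, hm, rfl⟩
  simp only [SetLike.mem_coe, LinearMap.mem_ker]
  rw [laplacian_monomial]
  refine Finset.sum_eq_zero fun j _ => ?_
  have h := ((mem_SS q n p k _).1 hm).1
  rw [Fintype.sum_sum_type] at h
  have h1 := Finset.single_le_sum (f := fun j => m (Sum.inl j))
    (fun _ _ => Nat.zero_le _) (Finset.mem_univ j)
  have h2 := Finset.single_le_sum (f := fun j => m (Sum.inr j))
    (fun _ _ => Nat.zero_le _) (Finset.mem_univ j)
  have h3 : m (Sum.inl j) = 0 ∨ m (Sum.inr j) = 0 := by omega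
  rcases h3 with h3 | h3 <;> simp [h3]

/-- absolutely convergent evaluation -/
def EE (z : ℂ) (f : PowerSeries ℂ) (v : ℂ) : Prop :=
  Summable (fun k => ‖PowerSeries.coeff k f * z ^ k‖) ∧
    HasSum (fun k => PowerSeries.coeff k f * z ^ k) v

lemma EE.mul {z : ℂ} {f g : PowerSeries ℂ} {a b : ℂ} (hf : EE z f a) (hg : EE z g b) :
    EE z (f * g) (a * b) := by
  have e : ∀ k, PowerSeries.coeff k (f * g) * z ^ k = ∑ kl ∈ Finset.HasAntidiagonal.antidiagonal k,
      (PowerSeries.coeff kl.1 f * z ^ kl.1) * (PowerSeries.coeff kl.2 g * z ^ kl.2) := by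
    intro k
    rw [PowerSeries.coeff_mul, Finset.sum_mul]
    refine Finset.sum_congr rfl fun kl hkl => ?_
    rw [← Finset.HasAntidiagonal.mem_antidiagonal.1 hkl, pow_add]
    ring
  have h1 := summable_norm_sum_mul_antidiagonal_of_summable_norm hf.1 hg.1
  have h2 := tsum_mul_tsum_eq_tsum_sum_antidiagonal_of_summable_norm hf.1 hg.1
  rw [hf.2.tsum_eq, hg.2.tsum_eq] at h2
  refine ⟨by simpa only [e] using h1, ?_⟩
  simp only [e]
  rw [h2]
  exact h1.of_norm.hasSum

lemma EE.add {z : ℂ} {f g : PowerSeries ℂ} {a b : ℂ} (hf : EE z f a) (hg : EE z g b) :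
    EE z (f + g) (a + b) := by
  have h := hf.2.add hg.2
  have e : ∀ k, PowerSeries.coeff k (f + g) * z ^ k =
      PowerSeries.coeff k f * z ^ k + PowerSeries.coeff k g * z ^ k := fun k => by
    rw [map_add, add_mul]
  refine ⟨?_, by simpa only [e] using h⟩
  simp only [e]
  exact Summable.of_nonneg_of_le (fun _ => norm_nonneg _) (fun _ => norm_add_le _ _)
    (hf.1.add hg.1)

lemma EE.monomial (z : ℂ) (d : ℕ) (a : ℂ) :
    EE z (PowerSeries.monomial d a) (a * z ^ d) := by
  have h : ∀ k, k ≠ d → PowerSeries.coeff k (PowerSeries.monomial d a) * z ^ k = 0 := fun k hk => by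
    rw [PowerSeries.coeff_monomial, if_neg hk, zero_mul]
  constructor
  · refine summable_of_ne_finset_zero (s := {d}) fun k hk => ?_
    rw [h k (by simpa using hk), norm_zero]
  · have := hasSum_single d h
    rwa [PowerSeries.coeff_monomial, if_pos rfl] at this

lemma EE.one (z : ℂ) : EE z 1 1 := by
  have := EE.monomial z 0 1
  simpa using this

lemma EE.prod {ι : Type*} (s : Finset ι) {z : ℂ} {f : ι → PowerSeries ℂ} {a : ι → ℂ}
    (h : ∀ i ∈ s, EE z (f i) (a i)) : EE z (∏ i ∈ s, f i) (∏ i ∈ s, a i) := by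
  classical
  induction s using Finset.induction_on with
  | empty => simpa using EE.one z
  | insert x s hx ih =>
    rw [Finset.prod_insert hx, Finset.prod_insert hx]
    exact (h x (by simp)).mul (ih fun i hi => h i (by simp [hi]))

lemma EE.sum {ι : Type*} (s : Finset ι) {z : ℂ} {f : ι → PowerSeries ℂ} {a : ι → ℂ}
    (h : ∀ i ∈ s, EE z (f i) (a i)) : EE z (∑ i ∈ s, f i) (∑ i ∈ s, a i) := by
  classical
  induction s using Finset.induction_on with
  | empty => simpa using EE.monomial z 0 0
  | insert x s hx ih =>
    rw [Finset.sum_insert hx, Finset.sum_insert hx]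
    exact (h x (by simp)).add (ih fun i hi => h i (by simp [hi]))

lemma EE.geom {z c : ℂ} (h : ‖c * z‖ < 1) : EE z (PowerSeries.mk fun k => c ^ k) (1 - c * z)⁻¹ := by
  have e : ∀ k, PowerSeries.coeff k (PowerSeries.mk fun k => c ^ k) * z ^ k = (c * z) ^ k :=
    fun k => by rw [PowerSeries.coeff_mk, mul_pow]
  unfold EE
  simp only [e]
  exact ⟨by simpa only [norm_pow] using summable_geometric_of_lt_one (norm_nonneg _) h,
    hasSum_geometric_of_norm_lt_one h⟩

lemma norm_rootU (q : ℕ) : ‖rootU q‖ = 1 := by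
  have : (2 * π * Complex.I / q : ℂ) = ((2 * π / q : ℝ) : ℂ) * Complex.I := by
    push_cast; ring
  rw [rootU, this, Complex.norm_exp_ofReal_mul_I]

lemma orth (q : ℕ) (hq : 0 < q) (w : ℤ) :
    ∑ l ∈ Finset.Icc 1 q, rootU q ^ (w * (l : ℤ)) = if (q : ℤ) ∣ w then (q : ℂ) else 0 := by
  have h := prim q hq
  simp only [zpow_mul, zpow_natCast]
  split_ifs with hw
  · rw [(h.zpow_eq_one_iff_dvd w).2 hw]
    simp
  · have h1 : rootU q ^ w ≠ 1 := fun h' => hw ((h.zpow_eq_one_iff_dvd w).1 h')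
    have h2 : (rootU q ^ w) ^ q = 1 := by
      rw [← zpow_natCast, ← zpow_mul]
      exact (h.zpow_eq_one_iff_dvd _).2 (dvd_mul_left _ _)
    have h3 : Finset.Icc 1 q = Finset.Ico 1 (q + 1) := by ext; simp
    rw [h3, geom_sum_Ico h1 (by omega), pow_succ, h2]
    simp

/-- the Molien-type series of `g ^ l` -/
def AA (q n : ℕ) (p : Fin n → ℤ) (l : ℤ) : PowerSeries ℂ :=
  ∏ s, PowerSeries.mk fun k => ev q n p l s ^ k

lemma coeff_AA (q n : ℕ) (p : Fin n → ℤ) (l : ℤ) (k : ℕ) :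
    PowerSeries.coeff k (AA q n p l) =
      ∑ m ∈ Finset.finsuppAntidiag Finset.univ k, rootU q ^ (wt n p m * l) := by
  rw [AA, PowerSeries.coeff_prod]
  simp only [PowerSeries.coeff_mk, prod_ev]

lemma card_SS (q n : ℕ) (hq : 0 < q) (p : Fin n → ℤ) (k : ℕ) :
    ((SS q n p k).card : ℂ) =
      (1 / q) * ∑ l ∈ Finset.Icc 1 q, PowerSeries.coeff k (AA q n p l) := by
  have hq' : (q : ℂ) ≠ 0 := Nat.cast_ne_zero.2 hq.ne'
  simp only [coeff_AA]
  rw [Finset.sum_comm]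
  simp only [orth q hq]
  rw [← Finset.sum_filter, Finset.sum_const, nsmul_eq_mul, SS]
  field_simp

lemma series_eq (q n : ℕ) (hq : 0 < q) (hn : 0 < n) (p : Fin n → ℤ) :
    (PowerSeries.mk fun k => (Module.finrank ℂ (HkG q n p k) : ℂ)) =
      (1 + PowerSeries.monomial 2 (-1)) * (PowerSeries.monomial 0 (1 / q : ℂ) *
        ∑ l ∈ Finset.Icc 1 q, AA q n p l) := by
  have h : (PowerSeries.monomial 0 (1 / q : ℂ) * ∑ l ∈ Finset.Icc 1 q, AA q n p l) =
      PowerSeries.mk fun k => ((SS q n p k).card : ℂ) := by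
    ext k
    rw [PowerSeries.coeff_mk, card_SS q n hq, PowerSeries.monomial_zero_eq_C_apply,
      PowerSeries.coeff_C_mul, map_sum]
  have h2 : (PowerSeries.monomial 2 (-1 : ℂ)) = - PowerSeries.X ^ 2 := by
    rw [PowerSeries.X_pow_eq, map_neg]
  rw [h, h2, add_mul, one_mul, neg_mul]
  ext k
  rw [map_add, map_neg, PowerSeries.coeff_X_pow_mul', PowerSeries.coeff_mk, PowerSeries.coeff_mk]
  split_ifs with hk
  · obtain ⟨j, rfl⟩ := Nat.exists_eq_add_of_le' hk
    rw [PowerSeries.coeff_mk, ← finrank_add_two q n hq hn p j, Nat.add_sub_cancel]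
    push_cast
    ring
  · rw [finrank_lt_two q n hq p k (by omega)]
    simp

lemma EE_AA (q n : ℕ) (p : Fin n → ℤ) (l : ℤ) (z : ℂ) (hz : ‖z‖ < 1) :
    EE z (AA q n p l)
      (∏ i, (z - rootU q ^ (p i * l)) * (z - rootU q ^ (-(p i) * l)))⁻¹ := by
  have h : EE z (AA q n p l) (∏ s, (1 - ev q n p l s * z)⁻¹) := by
    refine EE.prod _ fun s _ => EE.geom ?_
    have : ‖ev q n p l s‖ = 1 := by
      rcases s with i | i <;> simp [ev, norm_zpow, norm_rootU]
    rw [norm_mul, this, one_mul]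
    exact hz
  convert h using 1
  rw [Fintype.prod_sum_type, ← Finset.prod_mul_distrib, ← Finset.prod_inv_distrib]
  refine Finset.prod_congr rfl fun i _ => ?_
  rw [← mul_inv]
  congr 1
  simp only [ev, Sum.elim_inl, Sum.elim_inr]
  have : rootU q ^ (p i * l) * rootU q ^ (-(p i) * l) = 1 := by
    rw [← zpow_add₀ (rootU_ne q)]
    simp
  linear_combination (1 - z ^ 2) * this

/-- On the open unit disc, the generating function of the dimensions of the
spaces of `G`-invariant harmonic polynomials satisfies
`F_q(z) = (1/q) ∑_{l=1}^{q} (1 - z²) / ∏ᵢ (z - γ^{pᵢl})(z - γ^{-pᵢl})`. -/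
theorem stmt_18 (q n : ℕ) (hq : 0 < q) (hn : 0 < n) (p : Fin n → ℤ)
    (hp : IsCoprime (Finset.univ.gcd p) (q : ℤ)) :
    ∀ z : ℂ, ‖z‖ < 1 →
      ∑' k : ℕ, (Module.finrank ℂ (HkG q n p k) : ℂ) * z ^ k
        = (1 / q) * ∑ l ∈ Finset.Icc 1 q,
            (1 - z ^ 2) /
              ∏ i, (z - rootU q ^ (p i * l)) * (z - rootU q ^ (-(p i) * l)) := by
  intro z hz
  have h := ((EE.one z).add (EE.monomial z 2 (-1))).mul ((EE.monomial z 0 (1 / q : ℂ)).mul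
    (EE.sum (Finset.Icc 1 q) (f := fun l : ℕ => AA q n p l) fun l _ => EE_AA q n p l z hz))
  rw [← series_eq q n hq hn p] at h
  have h2 := h.2.tsum_eq
  simp only [PowerSeries.coeff_mk] at h2
  rw [h2]
  simp only [div_eq_mul_inv, ← Finset.mul_sum]
  ring

end
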